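/- Let L ≥ ‖D‖², let z* ∈ ℝⁿ with S* = supp(z*), assume the Gram matrix (D_{:,S*})ᵀ D_{:,S*} is invertible, and let J* = (J*_l)_{l=1}^m be the family of closed-form Jacobians. Then for any family J = (J_l)_{l=1}^m of n×n matrices, the operator norm of the linear map R(J, S*) from (ℝⁿ, ‖·‖₂) to (ℝ^{m×n}, ‖·‖_F) satisfies ‖R(J, S*)‖ ≤ L · ‖T_{J−J*}‖, where T_{J−J*} : ℝⁿ → ℝ^{m×n} is the linear map whose l-th row at v ∈ ℝⁿ is ((J_l − J*_l)ᵀ v)ᵀ and ‖T_{J−J*}‖ is its operator norm from (ℝⁿ, ‖·‖₂) to (ℝ^{m×n}, ‖·‖_F). -/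

import Mathlib

open scoped BigOperators
open Matrix

noncomputable def eunorm {α : Type*} [Fintype α] (v : α → ℝ) : ℝ :=
  Real.sqrt (∑ i, v i ^ 2)

noncomputable def frobnorm {α β : Type*} [Fintype α] [Fintype β] (A : Matrix α β ℝ) : ℝ :=
  Real.sqrt (∑ i, ∑ j, A i j ^ 2)

noncomputable def l2opnorm {α β : Type*} [Fintype α] [Fintype β] (A : Matrix α β ℝ) : ℝ :=
  sInf {c : ℝ | 0 ≤ c ∧ ∀ v : β → ℝ, eunorm (A.mulVec v) ≤ c * eunorm v}

open scoped Classical in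
noncomputable def supp {n : ℕ} (z : Fin n → ℝ) : Finset (Fin n) :=
  Finset.univ.filter fun i => z i ≠ 0

noncomputable def rowMask {n : ℕ} (S : Finset (Fin n)) (M : Matrix (Fin n) (Fin n) ℝ) :
    Matrix (Fin n) (Fin n) ℝ :=
  Matrix.of fun i j => if i ∈ S then M i j else 0

def restrVec {n : ℕ} (S : Finset (Fin n)) (h : Fin n → ℝ) : Fin n → ℝ :=
  fun i => if i ∈ S then h i else 0

def colSub {m n : ℕ} (D : Matrix (Fin m) (Fin n) ℝ) (S : Finset (Fin n)) :
    Matrix (Fin m) {i // i ∈ S} ℝ :=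
  D.submatrix id Subtype.val

noncomputable def gram {m n : ℕ} (D : Matrix (Fin m) (Fin n) ℝ) (S : Finset (Fin n)) :
    Matrix {i // i ∈ S} {i // i ∈ S} ℝ :=
  (colSub D S)ᵀ * colSub D S

noncomputable def Nmat {m n : ℕ} (D : Matrix (Fin m) (Fin n) ℝ) (y : Fin m → ℝ)
    (l : Fin m) (z : Fin n → ℝ) : Matrix (Fin n) (Fin n) ℝ :=
  Matrix.vecMulVec (D l) z + (dotProduct (D l) z - y l) • (1 : Matrix (Fin n) (Fin n) ℝ)

noncomputable def umat {m n : ℕ} (D : Matrix (Fin m) (Fin n) ℝ) (y : Fin m → ℝ)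
    (l : Fin m) (L : ℝ) (z : Fin n → ℝ) : Matrix (Fin n) (Fin n) ℝ :=
  (-(1 / L)) • Nmat D y l z

noncomputable def Gmat {m n : ℕ} (D : Matrix (Fin m) (Fin n) ℝ) (L : ℝ) :
    Matrix (Fin n) (Fin n) ℝ :=
  1 - (1 / L) • (Dᵀ * D)

noncomputable def Jstar {m n : ℕ} (D : Matrix (Fin m) (Fin n) ℝ) (y : Fin m → ℝ)
    (l : Fin m) (z : Fin n → ℝ) (S : Finset (Fin n)) : Matrix (Fin n) (Fin n) ℝ :=
  Matrix.of fun i j =>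
    if h : i ∈ S then
      (-((gram D S)⁻¹ * (Nmat D y l z).submatrix (Subtype.val : {i // i ∈ S} → Fin n) id))
        ⟨i, h⟩ j
    else 0

noncomputable def Rmap {m n : ℕ} (D : Matrix (Fin m) (Fin n) ℝ) (y : Fin m → ℝ)
    (zstar : Fin n → ℝ) (J : Fin m → Matrix (Fin n) (Fin n) ℝ) (S : Finset (Fin n))
    (h : Fin n → ℝ) : Matrix (Fin m) (Fin n) ℝ :=
  Matrix.of fun l j =>
    ((J l)ᵀ.mulVec ((Dᵀ * D).mulVec (restrVec S h))) j
      + (D.mulVec (restrVec S h)) l * zstar j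
      + (D.mulVec zstar - y) l * restrVec S h j

noncomputable def mapOpNorm {m n : ℕ} (Φ : (Fin n → ℝ) → Matrix (Fin m) (Fin n) ℝ) : ℝ :=
  sInf {c : ℝ | 0 ≤ c ∧ ∀ h : Fin n → ℝ, frobnorm (Φ h) ≤ c * eunorm h}

noncomputable def Mmat {m n : ℕ} (D : Matrix (Fin m) (Fin n) ℝ) (Sstar E : Finset (Fin n))
    (U : Matrix (Fin n) (Fin n) ℝ) : Matrix (Fin n) (Fin n) ℝ :=
  Matrix.of fun i j =>
    if h : i ∈ E then
      U i j -
        ((colSub D E)ᵀ * colSub D Sstar * (gram D Sstar)⁻¹ *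
          U.submatrix (Subtype.val : {i // i ∈ Sstar} → Fin n) id) ⟨i, h⟩ j
    else 0

noncomputable def Cmat {m n : ℕ} (D : Matrix (Fin m) (Fin n) ℝ) (Sstar E : Finset (Fin n)) :
    Matrix (Fin n) (Fin n) ℝ :=
  Matrix.of fun i j =>
    if h : i ∈ E then
      if h' : j ∈ Sstar then
        ((colSub D E)ᵀ * colSub D Sstar * (gram D Sstar)⁻¹) ⟨i, h⟩ ⟨j, h'⟩
      else 0
    else 0

noncomputable def Pdiag {n : ℕ} (S : Finset (Fin n)) : Matrix (Fin n) (Fin n) ℝ :=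
  Matrix.diagonal fun i => if i ∈ S then (1 : ℝ) else 0

noncomputable def STv {n : ℕ} (μ : ℝ) (x : Fin n → ℝ) : Fin n → ℝ :=
  fun i => Real.sign (x i) * max (|x i| - μ) 0

open scoped Matrix.Norms.L2Operator in
theorem eunorm_mulVec_le {α β : Type*} [Fintype α] [Fintype β] [DecidableEq β]
    (A : Matrix α β ℝ) (v : β → ℝ) : eunorm (A *ᵥ v) ≤ ‖A‖ * eunorm v := by
  simpa [eunorm, EuclideanSpace.norm_eq] using Matrix.l2_opNorm_mulVec A (WithLp.toLp 2 v)

open scoped Matrix.Norms.L2Operator in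
theorem norm_le_l2opnorm {α β : Type*} [Fintype α] [Fintype β] [DecidableEq β]
    (A : Matrix α β ℝ) : ‖A‖ ≤ l2opnorm A := by
  refine le_csInf ⟨‖A‖, norm_nonneg A, eunorm_mulVec_le A⟩ ?_
  rintro c ⟨hc, h⟩
  rw [Matrix.l2_opNorm_def]
  refine ContinuousLinearMap.opNorm_le_bound _ hc fun v => ?_
  simpa [eunorm, EuclideanSpace.norm_eq] using h v.ofLp

open scoped Matrix.Norms.L2Operator in
theorem eunorm_gram_mulVec_le {α β : Type*} [Fintype α] [Fintype β]
    (A : Matrix α β ℝ) (v : β → ℝ) : eunorm ((Aᵀ * A) *ᵥ v) ≤ l2opnorm A ^ 2 * eunorm v := by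
  classical
  calc eunorm ((Aᵀ * A) *ᵥ v) ≤ ‖Aᵀ * A‖ * eunorm v := eunorm_mulVec_le _ v
    _ = ‖A‖ ^ 2 * eunorm v := by
      rw [← Matrix.conjTranspose_eq_transpose_of_trivial, Matrix.l2_opNorm_conjTranspose_mul_self,
        sq]
    _ ≤ l2opnorm A ^ 2 * eunorm v := by
      have := norm_le_l2opnorm A
      have hv : 0 ≤ eunorm v := Real.sqrt_nonneg _
      gcongr

theorem eunorm_restrVec_le {n : ℕ} (S : Finset (Fin n)) (h : Fin n → ℝ) :
    eunorm (restrVec S h) ≤ eunorm h := by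
  refine Real.sqrt_le_sqrt (Finset.sum_le_sum fun i _ => ?_)
  unfold restrVec
  split_ifs
  · exact le_rfl
  · simpa using sq_nonneg (h i)

theorem frobnorm_le_mapOpNorm_mul {m n : ℕ} {Φ : (Fin n → ℝ) → Matrix (Fin m) (Fin n) ℝ} {C : ℝ}
    (hC : 0 ≤ C) (hΦ : ∀ v, frobnorm (Φ v) ≤ C * eunorm v) (v : Fin n → ℝ) :
    frobnorm (Φ v) ≤ mapOpNorm Φ * eunorm v := by
  have hv0 : 0 ≤ eunorm v := Real.sqrt_nonneg _
  rcases hv0.eq_or_lt with hv | hv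
  · simpa [← hv] using hΦ v
  · rw [← div_le_iff₀ hv]
    exact le_csInf ⟨C, hC, hΦ⟩ fun c hc => (div_le_iff₀ hv).2 (hc.2 v)

theorem mapOpNorm_nonneg {m n : ℕ} (Φ : (Fin n → ℝ) → Matrix (Fin m) (Fin n) ℝ) :
    0 ≤ mapOpNorm Φ :=
  Real.sInf_nonneg fun _ hc => hc.1

open scoped Matrix.Norms.L2Operator in
theorem frobnorm_transpose_mulVec_le {m n : ℕ} (A : Fin m → Matrix (Fin n) (Fin n) ℝ) :
    ∃ C, 0 ≤ C ∧ ∀ v : Fin n → ℝ,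
      frobnorm (Matrix.of fun l j => ((A l)ᵀ *ᵥ v) j) ≤ C * eunorm v := by
  let B : Matrix (Fin m × Fin n) (Fin n) ℝ := Matrix.of fun p i => A p.1 i p.2
  refine ⟨‖B‖, norm_nonneg B, fun v => ?_⟩
  refine le_of_eq_of_le ?_ (eunorm_mulVec_le B v)
  rw [frobnorm, eunorm, Fintype.sum_prod_type]
  rfl

theorem gram_mulVec_restrict {m n : ℕ} (D : Matrix (Fin m) (Fin n) ℝ) (S : Finset (Fin n))
    (h : Fin n → ℝ) :
    gram D S *ᵥ (fun i => h i) = fun i : {i // i ∈ S} => ((Dᵀ * D) *ᵥ restrVec S h) i := by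
  ext i
  simp only [Matrix.mulVec, dotProduct, _root_.gram, colSub, restrVec, mul_ite, mul_zero,
    Finset.sum_ite_mem, Finset.univ_inter]
  rw [← Finset.sum_coe_sort S]
  rfl

theorem Jstar_transpose_mulVec {m n : ℕ} (D : Matrix (Fin m) (Fin n) ℝ) (y : Fin m → ℝ)
    (l : Fin m) (z : Fin n → ℝ) (S : Finset (Fin n)) (hGram : IsUnit (gram D S))
    (h : Fin n → ℝ) :
    (Jstar D y l z S)ᵀ *ᵥ ((Dᵀ * D) *ᵥ restrVec S h) = -((Nmat D y l z)ᵀ *ᵥ restrVec S h) := by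
  set N := (Nmat D y l z).submatrix (Subtype.val : {i // i ∈ S} → Fin n) id with hN
  set w := (Dᵀ * D) *ᵥ restrVec S h with hw
  have hdet : IsUnit (gram D S).det := (Matrix.isUnit_iff_isUnit_det _).1 hGram
  have hsymm : (gram D S)ᵀ = gram D S := by simp [_root_.gram, Matrix.transpose_mul]
  have hJ : (Jstar D y l z S)ᵀ *ᵥ w = (-((gram D S)⁻¹ * N))ᵀ *ᵥ fun i => w i := by
    ext j
    simp only [Matrix.mulVec, dotProduct, Matrix.transpose_apply, Jstar, Matrix.of_apply]
    rw [← Finset.sum_subset (Finset.subset_univ S), ← Finset.sum_coe_sort S]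
    · exact Finset.sum_congr rfl fun i _ => by rw [dif_pos i.2]
    · intro i _ hi
      rw [dif_neg hi, zero_mul]
  have hNh : (Nmat D y l z)ᵀ *ᵥ restrVec S h = Nᵀ *ᵥ fun i => h i := by
    ext j
    simp only [Matrix.mulVec, dotProduct, restrVec, mul_ite, mul_zero, Finset.sum_ite_mem,
      Finset.univ_inter]
    rw [← Finset.sum_coe_sort S]
    rfl
  rw [hJ, hNh, hw, ← gram_mulVec_restrict, Matrix.transpose_neg, Matrix.neg_mulVec,
    Matrix.transpose_mul, Matrix.transpose_nonsing_inv, hsymm, Matrix.mulVec_mulVec,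
    Matrix.mul_assoc, Matrix.nonsing_inv_mul _ hdet, Matrix.mul_one]

theorem Nmat_transpose_mulVec {m n : ℕ} (D : Matrix (Fin m) (Fin n) ℝ) (y : Fin m → ℝ)
    (l : Fin m) (z v : Fin n → ℝ) :
    (Nmat D y l z)ᵀ *ᵥ v = (D *ᵥ v) l • z + (D *ᵥ z - y) l • v := by
  rw [Nmat, Matrix.transpose_add, Matrix.add_mulVec, Matrix.transpose_smul, Matrix.transpose_one,
    Matrix.smul_mulVec, Matrix.one_mulVec, Matrix.transpose_vecMulVec, Matrix.vecMulVec_mulVec]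
  ext j
  simp [Matrix.mulVec]

theorem Rmap_eq_jacobian_diff {m n : ℕ} (D : Matrix (Fin m) (Fin n) ℝ) (y : Fin m → ℝ)
    (z : Fin n → ℝ) (J : Fin m → Matrix (Fin n) (Fin n) ℝ) (S : Finset (Fin n))
    (hGram : IsUnit (gram D S)) (h : Fin n → ℝ) :
    Rmap D y z J S h = Matrix.of fun l j =>
      ((J l - Jstar D y l z S)ᵀ *ᵥ ((Dᵀ * D) *ᵥ restrVec S h)) j := by
  ext l j
  simp only [Rmap, Matrix.of_apply, Matrix.transpose_sub, Matrix.sub_mulVec,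
    Jstar_transpose_mulVec D y l z S hGram h, Nmat_transpose_mulVec, Pi.sub_apply, Pi.neg_apply,
    Pi.add_apply, Pi.smul_apply, smul_eq_mul]
  ring

/-- the operator norm of `R(J, S*)` is controlled by `L` times the
operator norm of the map built from `J − J*`. -/
theorem Rmap_opNorm_le_L_mul_jacobian_diff
    {m n : ℕ} (D : Matrix (Fin m) (Fin n) ℝ) (y : Fin m → ℝ)
    (L : ℝ) (hL : l2opnorm D ^ 2 ≤ L)
    (zstar : Fin n → ℝ)
    (hGram : IsUnit (gram D (supp zstar)))
    (J : Fin m → Matrix (Fin n) (Fin n) ℝ) :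
    mapOpNorm (Rmap D y zstar J (supp zstar)) ≤
      L * mapOpNorm (fun v => Matrix.of fun l j =>
        ((J l - Jstar D y l zstar (supp zstar))ᵀ.mulVec v) j) := by
  obtain ⟨C, hC, hT⟩ :=
    frobnorm_transpose_mulVec_le fun l => J l - Jstar D y l zstar (supp zstar)
  set T : (Fin n → ℝ) → Matrix (Fin m) (Fin n) ℝ := fun v => Matrix.of fun l j =>
    ((J l - Jstar D y l zstar (supp zstar))ᵀ.mulVec v) j
  have hL0 : 0 ≤ L := (sq_nonneg _).trans hL
  have hT0 : 0 ≤ mapOpNorm T := mapOpNorm_nonneg T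
  refine csInf_le ⟨0, fun c hc => hc.1⟩ ⟨mul_nonneg hL0 hT0, fun h => ?_⟩
  have hh : 0 ≤ eunorm h := Real.sqrt_nonneg _
  calc frobnorm (Rmap D y zstar J (supp zstar) h)
      = frobnorm (T ((Dᵀ * D) *ᵥ restrVec (supp zstar) h)) := by
        rw [Rmap_eq_jacobian_diff D y zstar J _ hGram]
    _ ≤ mapOpNorm T * eunorm ((Dᵀ * D) *ᵥ restrVec (supp zstar) h) :=
        frobnorm_le_mapOpNorm_mul hC hT _
    _ ≤ mapOpNorm T * (l2opnorm D ^ 2 * eunorm (restrVec (supp zstar) h)) := by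
        gcongr
        exact eunorm_gram_mulVec_le D _
    _ ≤ mapOpNorm T * (L * eunorm h) := by
        gcongr ?_ * ?_
        exact mul_le_mul hL (eunorm_restrVec_le _ h) (Real.sqrt_nonneg _) hL0
    _ = L * mapOpNorm T * eunorm h := by ring
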